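/- arXiv:2012.03155 — 2 statements merged into one kernel-verified Lean document; each statement's English description precedes it below -/
import Mathlib

section
/- Let r ≥ 3 and ℓ ≥ 2, and let G be the graph obtained from the complete graph K^r on vertices u_1, ..., u_r by deleting the edge u_1u_2 and adding a path of length ℓ from u_1 to u_2 through ℓ - 1 new vertices. Then G does not contain K_{1,r} as a minor. -/
/-- `H.IsMinorOf G` : `H` is a minor of `G`, via the branch-set (model) definition:
there are pairwise disjoint nonempty connected subsets of `V(G)`, one for each vertex
of `H`, with an edge of `G` between the branch sets corresponding to each edge of `H`. -/
def SimpleGraph.IsMinorOf {W V : Type*} (H : SimpleGraph W) (G : SimpleGraph V) : Prop :=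
  ∃ B : W → Set V,
    (∀ w, (B w).Nonempty) ∧
    (∀ w, (G.induce (B w)).Connected) ∧
    (Pairwise fun w₁ w₂ => Disjoint (B w₁) (B w₂)) ∧
    ∀ ⦃w₁ w₂⦄, H.Adj w₁ w₂ → ∃ v₁ ∈ B w₁, ∃ v₂ ∈ B w₂, G.Adj v₁ v₂

/-- The graph `G + uv` obtained from `G` by adding the edge `uv`. -/
def SimpleGraph.addEdge {V : Type*} (G : SimpleGraph V) (u v : V) : SimpleGraph V :=
  G ⊔ SimpleGraph.fromEdgeSet {s(u, v)}

/-- `G` is `M(H)`-saturated: `G` has no `H`-minor, but adding any edge between two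
distinct non-adjacent vertices creates an `H`-minor. -/
def MinorSaturated {W V : Type*} (H : SimpleGraph W) (G : SimpleGraph V) : Prop :=
  ¬ H.IsMinorOf G ∧
    ∀ u v : V, u ≠ v → ¬ G.Adj u v → H.IsMinorOf (G.addEdge u v)

/-- The graph obtained from the complete graph `K^r` (on `Fin r`, with `u₁ = 0` and
`u₂ = 1`) by deleting the edge `u₁u₂` and adding a path of length `ℓ` from `u₁` to `u₂`
through `ℓ - 1` new vertices `p_0, …, p_{ℓ-2}` (so `u₁ ~ p_0`, `p_i ~ p_{i+1}`, and
`p_{ℓ-2} ~ u₂`). -/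
def pathReplacedComplete (r ℓ : ℕ) : SimpleGraph (Fin r ⊕ Fin (ℓ - 1)) :=
  SimpleGraph.fromRel fun a b =>
    match a, b with
    | Sum.inl i, Sum.inl j => ¬(i.val = 0 ∧ j.val = 1) ∧ ¬(i.val = 1 ∧ j.val = 0)
    | Sum.inl i, Sum.inr p => (i.val = 0 ∧ p.val = 0) ∨ (i.val = 1 ∧ p.val = ℓ - 2)
    | Sum.inr p, Sum.inr q => q.val = p.val + 1
    | Sum.inr _, Sum.inl _ => False

theorem SimpleGraph.exists_adj_of_induce_connected {V : Type*} {G : SimpleGraph V} {S : Set V}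
    (hS : (G.induce S).Connected) (T : Set V) {x y : V} (hxS : x ∈ S) (hx : x ∈ T)
    (hyS : y ∈ S) (hy : y ∉ T) : ∃ a ∈ S, ∃ b ∈ S, a ∈ T ∧ b ∉ T ∧ G.Adj a b := by
  obtain ⟨w⟩ := hS.preconnected ⟨x, hxS⟩ ⟨y, hyS⟩
  obtain ⟨d, -, h₁, h₂⟩ := w.exists_boundary_dart {v | (v : V) ∈ T} hx hy
  exact ⟨d.fst, d.fst.2, d.snd, d.snd.2, h₁, h₂, d.adj⟩

namespace pathReplacedComplete

variable {r ℓ : ℕ}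

theorem adj_inl_inl {i j : Fin r} :
    (pathReplacedComplete r ℓ).Adj (.inl i) (.inl j) ↔
      i ≠ j ∧ ¬(i.val = 0 ∧ j.val = 1) ∧ ¬(i.val = 1 ∧ j.val = 0) := by
  simp only [pathReplacedComplete, SimpleGraph.fromRel_adj, ne_eq, Sum.inl.injEq]
  tauto

theorem adj_inl_inr {i : Fin r} {p : Fin (ℓ - 1)} :
    (pathReplacedComplete r ℓ).Adj (.inl i) (.inr p) ↔
      (i.val = 0 ∧ p.val = 0) ∨ (i.val = 1 ∧ p.val = ℓ - 2) := by
  simp [pathReplacedComplete, SimpleGraph.fromRel_adj]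

theorem adj_inr_inl {i : Fin r} {p : Fin (ℓ - 1)} :
    (pathReplacedComplete r ℓ).Adj (.inr p) (.inl i) ↔
      (i.val = 0 ∧ p.val = 0) ∨ (i.val = 1 ∧ p.val = ℓ - 2) := by
  rw [SimpleGraph.adj_comm, adj_inl_inr]

theorem adj_inr_inr {p q : Fin (ℓ - 1)} :
    (pathReplacedComplete r ℓ).Adj (.inr p) (.inr q) ↔
      q.val = p.val + 1 ∨ p.val = q.val + 1 := by
  simp only [pathReplacedComplete, SimpleGraph.fromRel_adj, ne_eq, Sum.inr.injEq, Fin.ext_iff]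
  omega

variable {S : Set (Fin r ⊕ Fin (ℓ - 1))}

/-- A connected set meeting the clique has no vertex strictly between two path vertices
outside it. -/
theorem not_mem_between (hS : ((pathReplacedComplete r ℓ).induce S).Connected)
    {u : Fin r} (hu : .inl u ∈ S) {p q m : Fin (ℓ - 1)} (hp : .inr p ∉ S) (hq : .inr q ∉ S)
    (hpm : p < m) (hmq : m < q) : .inr m ∉ S := by
  intro hm
  obtain ⟨a, ha, b, hb, haT, hbT, hab⟩ := SimpleGraph.exists_adj_of_induce_connected hS
    {v | ∃ i, v = .inr i ∧ p < i ∧ i < q} hm ⟨m, rfl, hpm, hmq⟩ hu (by simp)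
  obtain ⟨i, rfl, h₁, h₂⟩ := haT
  rcases b with j | j
  · have := adj_inr_inl.1 hab
    have := q.isLt
    omega
  · have hjp : j ≠ p := by rintro rfl; exact hp hb
    have hjq : j ≠ q := by rintro rfl; exact hq hb
    have := adj_inr_inr.1 hab
    exact hbT ⟨j, rfl, by omega, by omega⟩

/-- A connected set meeting the clique but missing `p` can only reach path vertices before `p`
through `u₁`. -/
theorem inl_zero_mem (hS : ((pathReplacedComplete r ℓ).induce S).Connected)
    {u z : Fin r} (hu : .inl u ∈ S) (hz : z.val = 0) {p m : Fin (ℓ - 1)} (hp : .inr p ∉ S)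
    (hmp : m < p) (hm : .inr m ∈ S) : .inl z ∈ S := by
  obtain ⟨a, ha, b, hb, haT, hbT, hab⟩ := SimpleGraph.exists_adj_of_induce_connected hS
    {v | ∃ i, v = .inr i ∧ i < p} hm ⟨m, rfl, hmp⟩ hu (by simp)
  obtain ⟨i, rfl, h₁⟩ := haT
  rcases b with j | j
  · have := adj_inr_inl.1 hab
    have := p.isLt
    obtain rfl : j = z := by omega
    exact hb
  · have hjp : j ≠ p := by rintro rfl; exact hp hb
    have := adj_inr_inr.1 hab
    exact absurd ⟨j, rfl, by omega⟩ hbT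

/-- A connected set meeting the clique but missing `p` can only reach path vertices after `p`
through `u₂`. -/
theorem inl_one_mem (hS : ((pathReplacedComplete r ℓ).induce S).Connected)
    {u o : Fin r} (hu : .inl u ∈ S) (ho : o.val = 1) {p m : Fin (ℓ - 1)} (hp : .inr p ∉ S)
    (hpm : p < m) (hm : .inr m ∈ S) : .inl o ∈ S := by
  obtain ⟨a, ha, b, hb, haT, hbT, hab⟩ := SimpleGraph.exists_adj_of_induce_connected hS
    {v | ∃ i, v = .inr i ∧ p < i} hm ⟨m, rfl, hpm⟩ hu (by simp)
  obtain ⟨i, rfl, h₁⟩ := haT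
  rcases b with j | j
  · have := adj_inr_inl.1 hab
    obtain rfl : j = o := by omega
    exact hb
  · have hjp : j ≠ p := by rintro rfl; exact hp hb
    have := adj_inr_inr.1 hab
    exact absurd ⟨j, rfl, by omega⟩ hbT

/-- The position of a vertex along the path from `u₁` to `u₂`; only meaningful for the
vertices of that path. -/
def pos : Fin r ⊕ Fin (ℓ - 1) → ℕ
  | .inl i => if i.val = 0 then 0 else ℓ
  | .inr p => p.val + 1

theorem pos_eq_of_adj_inr (hℓ : 2 ≤ ℓ) {q : Fin (ℓ - 1)} {b : Fin r ⊕ Fin (ℓ - 1)}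
    (h : (pathReplacedComplete r ℓ).Adj (.inr q) b) :
    pos b = q.val + 2 ∨ pos b = q.val := by
  rcases b with j | j
  · have := adj_inr_inl.1 h
    simp only [pos]
    split_ifs <;> omega
  · have := adj_inr_inr.1 h
    simp only [pos]
    omega

theorem eq_of_pos_eq {q q' : Fin (ℓ - 1)} {b b' : Fin r ⊕ Fin (ℓ - 1)}
    (h : (pathReplacedComplete r ℓ).Adj (.inr q) b)
    (h' : (pathReplacedComplete r ℓ).Adj (.inr q') b') (hpos : pos b = pos b') : b = b' := by
  rcases b with j | j <;> rcases b' with j' | j' <;>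
    simp only [pos, adj_inr_inl, adj_inr_inr] at h h' hpos <;>
    simp only [Sum.inl.injEq, Sum.inr.injEq, reduceCtorEq, Fin.ext_iff] <;>
    (try split_ifs at hpos) <;> omega

theorem lt_or_lt_pos (hS : ((pathReplacedComplete r ℓ).induce S).Connected)
    (hU : ∀ u, .inl u ∉ S) {b : Fin r ⊕ Fin (ℓ - 1)} (hb : b ∉ S) :
    (∀ q, .inr q ∈ S → pos b < q.val + 1) ∨ (∀ q, .inr q ∈ S → q.val + 1 < pos b) := by
  by_contra! hcon
  obtain ⟨⟨q, hq, hqb⟩, q', hq', hqb'⟩ := hcon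
  have key : ∀ i : Fin (ℓ - 1), .inr i ∈ S → i.val + 1 ≠ pos b := by
    intro i hi h
    rcases b with j | j
    · simp only [pos] at h
      have := i.isLt
      split_ifs at h
      omega
    · simp only [pos] at h
      obtain rfl : i = j := by omega
      exact hb hi
  have hne := key q hq
  obtain ⟨x, hx, y, hy, hxT, hyT, hxy⟩ := SimpleGraph.exists_adj_of_induce_connected hS
    {v | ∃ i : Fin (ℓ - 1), v = .inr i ∧ i.val + 1 < pos b} hq ⟨q, rfl, by omega⟩ hq'
    (by rintro ⟨i, h, hi⟩; obtain rfl := Sum.inr_injective h; omega)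
  obtain ⟨i, rfl, hi⟩ := hxT
  rcases y with j | j
  · exact hU _ hy
  · have := adj_inr_inr.1 hxy
    have := key j hy
    exact hyT ⟨j, rfl, by omega⟩

/-- A connected set of path vertices has at most two outer neighbours. -/
theorem card_le_two (hℓ : 2 ≤ ℓ) (hS : ((pathReplacedComplete r ℓ).induce S).Connected)
    (hU : ∀ u, .inl u ∉ S) (B : Finset (Fin r ⊕ Fin (ℓ - 1)))
    (hB : ∀ b ∈ B, b ∉ S ∧ ∃ s ∈ S, (pathReplacedComplete r ℓ).Adj s b) : B.card ≤ 2 := by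
  have hN : ∀ b ∈ B, ∃ q : Fin (ℓ - 1), .inr q ∈ S ∧ (pathReplacedComplete r ℓ).Adj (.inr q) b := by
    intro b hb
    obtain ⟨-, s | s, hs, h⟩ := hB b hb
    · exact absurd hs (hU s)
    · exact ⟨s, hs, h⟩
  have hlow : ∀ b ∈ B, ∀ b' ∈ B, (∀ q, .inr q ∈ S → pos b < q.val + 1) →
      (∀ q, .inr q ∈ S → pos b' < q.val + 1) → b = b' := by
    intro b hb b' hb' h h'
    obtain ⟨q, hq, hqb⟩ := hN b hb
    obtain ⟨q', hq', hqb'⟩ := hN b' hb'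
    have := pos_eq_of_adj_inr hℓ hqb
    have := pos_eq_of_adj_inr hℓ hqb'
    have := h q hq
    have := h q' hq'
    have := h' q hq
    have := h' q' hq'
    exact eq_of_pos_eq hqb hqb' (by omega)
  have hhigh : ∀ b ∈ B, ∀ b' ∈ B, (∀ q, .inr q ∈ S → q.val + 1 < pos b) →
      (∀ q, .inr q ∈ S → q.val + 1 < pos b') → b = b' := by
    intro b hb b' hb' h h'
    obtain ⟨q, hq, hqb⟩ := hN b hb
    obtain ⟨q', hq', hqb'⟩ := hN b' hb'
    have := pos_eq_of_adj_inr hℓ hqb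
    have := pos_eq_of_adj_inr hℓ hqb'
    have := h q hq
    have := h q' hq'
    have := h' q hq
    have := h' q' hq'
    exact eq_of_pos_eq hqb hqb' (by omega)
  by_contra! hcard
  obtain ⟨a, ha, b, hb, c, hc, hab, hac, hbc⟩ := Finset.two_lt_card.1 hcard
  rcases lt_or_lt_pos hS hU (hB a ha).1 with h₁ | h₁ <;>
  rcases lt_or_lt_pos hS hU (hB b hb).1 with h₂ | h₂ <;>
  rcases lt_or_lt_pos hS hU (hB c hc).1 with h₃ | h₃ <;>
  first
  | exact hab (hlow a ha b hb h₁ h₂)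
  | exact hac (hlow a ha c hc h₁ h₃)
  | exact hbc (hlow b hb c hc h₂ h₃)
  | exact hab (hhigh a ha b hb h₁ h₂)
  | exact hac (hhigh a ha c hc h₁ h₃)
  | exact hbc (hhigh b hb c hc h₂ h₃)

/-- The possible neighbours in `S` of a path vertex. -/
theorem exists_neighbour {p : Fin (ℓ - 1)} {z o : Fin r} (hz : z.val = 0) (ho : o.val = 1)
    (h : ∃ s ∈ S, (pathReplacedComplete r ℓ).Adj s (.inr p)) :
    (.inl z ∈ S ∧ p.val = 0) ∨ (∃ m, m.val + 1 = p.val ∧ .inr m ∈ S) ∨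
      (.inl o ∈ S ∧ p.val = ℓ - 2) ∨ (∃ m, m.val = p.val + 1 ∧ .inr m ∈ S) := by
  obtain ⟨i | m, hs, h⟩ := h
  · rcases adj_inl_inr.1 h with ⟨hi, hp⟩ | ⟨hi, hp⟩
    · obtain rfl : i = z := by omega
      exact .inl ⟨hs, hp⟩
    · obtain rfl : i = o := by omega
      exact .inr (.inr (.inl ⟨hs, hp⟩))
  · rcases adj_inr_inr.1 h with hm | hm
    · exact .inr (.inl ⟨m, hm.symm, hs⟩)
    · exact .inr (.inr (.inr ⟨m, hm, hs⟩))

/-- A connected set meeting the clique with an outer neighbour on the path contains `u₁`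
or `u₂`. -/
theorem inl_zero_or_inl_one_mem (hS : ((pathReplacedComplete r ℓ).induce S).Connected)
    {u z o : Fin r} (hu : .inl u ∈ S) (hz : z.val = 0) (ho : o.val = 1) {p : Fin (ℓ - 1)}
    (hp : .inr p ∉ S) (h : ∃ s ∈ S, (pathReplacedComplete r ℓ).Adj s (.inr p)) :
    .inl z ∈ S ∨ .inl o ∈ S := by
  rcases exists_neighbour hz ho h with ⟨h, -⟩ | ⟨m, hm, h⟩ | ⟨h, -⟩ | ⟨m, hm, h⟩
  · exact .inl h
  · exact .inl (inl_zero_mem hS hu hz hp (by omega) h)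
  · exact .inr h
  · exact .inr (inl_one_mem hS hu ho hp (by omega) h)

/-- If a connected set meeting the clique has an outer neighbour on the path, then two clique
vertices are not outer neighbours of it. -/
theorem exists_pair (hS : ((pathReplacedComplete r ℓ).induce S).Connected)
    {u z o : Fin r} (hu : .inl u ∈ S) (hz : z.val = 0) (ho : o.val = 1) {p : Fin (ℓ - 1)}
    (hp : .inr p ∉ S) (h : ∃ s ∈ S, (pathReplacedComplete r ℓ).Adj s (.inr p)) :
    ∃ v w : Fin r, v ≠ w ∧ .inl v ∈ S ∧
      (.inl w ∈ S ∨ ∀ s ∈ S, ¬(pathReplacedComplete r ℓ).Adj s (.inl w)) := by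
  by_cases huniq : ∃ w, w ≠ u ∧ .inl w ∈ S
  · obtain ⟨w, hwu, hw⟩ := huniq
    exact ⟨u, w, hwu.symm, hu, .inl hw⟩
  push Not at huniq
  have huniq' : ∀ w, .inl w ∈ S → w = u := fun w hw => by_contra fun hne => huniq w hne hw
  rcases inl_zero_or_inl_one_mem hS hu hz ho hp h with hmem | hmem
  · refine ⟨z, o, by omega, hmem, .inr ?_⟩
    have hoS : .inl o ∉ S := fun ho' => by
      have := huniq' _ ho'
      have := huniq' _ hmem
      omega
    rintro (i | q) hs hadj
    · have := huniq' _ hs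
      have := huniq' _ hmem
      have := adj_inl_inl.1 hadj
      omega
    · have hpq : q ≠ p := by rintro rfl; exact hp hs
      have := adj_inr_inl.1 hadj
      exact hoS (inl_one_mem hS hu ho hp (by omega) hs)
  · refine ⟨o, z, by omega, hmem, .inr ?_⟩
    have hzS : .inl z ∉ S := fun hz' => by
      have := huniq' _ hz'
      have := huniq' _ hmem
      omega
    rintro (i | q) hs hadj
    · have := huniq' _ hs
      have := huniq' _ hmem
      have := adj_inl_inl.1 hadj
      omega
    · have hpq : q ≠ p := by rintro rfl; exact hp hs
      have := adj_inr_inl.1 hadj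
      exact hzS (inl_zero_mem hS hu hz hp (by omega) hs)

/-- If a connected set meeting the clique has two outer neighbours on the path, then it contains
`u₁`, `u₂` and a third clique vertex. -/
theorem exists_triple (hS : ((pathReplacedComplete r ℓ).induce S).Connected)
    {u z o : Fin r} (hu : .inl u ∈ S) (hz : z.val = 0) (ho : o.val = 1) {p q : Fin (ℓ - 1)}
    (hpq : p < q) (hp : .inr p ∉ S) (hq : .inr q ∉ S)
    (hpN : ∃ s ∈ S, (pathReplacedComplete r ℓ).Adj s (.inr p))
    (hqN : ∃ s ∈ S, (pathReplacedComplete r ℓ).Adj s (.inr q)) :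
    .inl z ∈ S ∧ .inl o ∈ S ∧ ∃ w, w ≠ z ∧ w ≠ o ∧ .inl w ∈ S := by
  have hzS : .inl z ∈ S := by
    rcases exists_neighbour hz ho hpN with ⟨h, -⟩ | ⟨m, hm, h⟩ | ⟨h, hl⟩ | ⟨m, hm, h⟩
    · exact h
    · exact inl_zero_mem hS hu hz hp (by omega) h
    · omega
    · have hmq : m ≠ q := by rintro rfl; exact hq h
      exact absurd h (not_mem_between hS hu hp hq (by omega) (by omega))
  have hoS : .inl o ∈ S := by
    rcases exists_neighbour hz ho hqN with ⟨h, hl⟩ | ⟨m, hm, h⟩ | ⟨h, -⟩ | ⟨m, hm, h⟩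
    · omega
    · have hmp : m ≠ p := by rintro rfl; exact hp h
      exact absurd h (not_mem_between hS hu hp hq (by omega) (by omega))
    · exact h
    · exact inl_one_mem hS hu ho hq (by omega) h
  refine ⟨hzS, hoS, ?_⟩
  by_contra! hcon
  obtain ⟨a, ha, b, hb, haT, hbT, hab⟩ := SimpleGraph.exists_adj_of_induce_connected hS
    {v | v = .inl z ∨ ∃ i, v = .inr i ∧ i < p} hzS (.inl rfl) hoS
    (by
      rintro (h | ⟨i, h, -⟩)
      · have := Sum.inl_injective h
        omega
      · cases h)
  rcases b with j | j
  · have hjz : j ≠ z := by rintro rfl; exact hbT (.inl rfl)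
    obtain rfl : j = o := by_contra fun hne => hcon j hjz hne hb
    rcases haT with rfl | ⟨i, rfl, hi⟩
    · exact (adj_inl_inl.1 hab).2.1 ⟨hz, ho⟩
    · have := adj_inr_inl.1 hab
      omega
  · have hjp : j ≠ p := by rintro rfl; exact hp hb
    refine hbT (.inr ⟨j, rfl, ?_⟩)
    rcases haT with rfl | ⟨i, rfl, hi⟩
    · have := adj_inl_inr.1 hab
      omega
    · have := adj_inr_inr.1 hab
      omega

/-- A connected set meeting the clique has at most two outer neighbours on the path. -/
theorem false_of_three (hS : ((pathReplacedComplete r ℓ).induce S).Connected)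
    {u z o : Fin r} (hu : .inl u ∈ S) (hz : z.val = 0) (ho : o.val = 1) {p q t : Fin (ℓ - 1)}
    (hpq : p < q) (hqt : q < t) (hp : .inr p ∉ S) (hq : .inr q ∉ S) (ht : .inr t ∉ S)
    (hqN : ∃ s ∈ S, (pathReplacedComplete r ℓ).Adj s (.inr q)) : False := by
  rcases exists_neighbour hz ho hqN with ⟨h, hl⟩ | ⟨m, hm, h⟩ | ⟨h, hl⟩ | ⟨m, hm, h⟩
  · omega
  · have hmp : m ≠ p := by rintro rfl; exact hp h
    exact not_mem_between hS hu hp hq (by omega) (by omega) h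
  · omega
  · have hmt : m ≠ t := by rintro rfl; exact ht h
    exact not_mem_between hS hu hq ht (by omega) (by omega) h

/-- A connected set of vertices has fewer than `r` outer neighbours. -/
theorem card_outer_neighbours_lt (hr : 3 ≤ r) (hℓ : 2 ≤ ℓ)
    (hS : ((pathReplacedComplete r ℓ).induce S).Connected)
    (B : Finset (Fin r ⊕ Fin (ℓ - 1)))
    (hB : ∀ b ∈ B, b ∉ S ∧ ∃ s ∈ S, (pathReplacedComplete r ℓ).Adj s b) : B.card < r := by
  by_cases hU : ∀ u, .inl u ∉ S
  · have := card_le_two hℓ hS hU B hB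
    omega
  push Not at hU
  obtain ⟨u, hu⟩ := hU
  obtain ⟨z, hz⟩ : ∃ z : Fin r, z.val = 0 := ⟨⟨0, by omega⟩, rfl⟩
  obtain ⟨o, ho⟩ : ∃ o : Fin r, o.val = 1 := ⟨⟨1, by omega⟩, rfl⟩
  have hR : ∀ p ∈ B.toRight, .inr p ∉ S ∧ ∃ s ∈ S, (pathReplacedComplete r ℓ).Adj s (.inr p) :=
    fun p hp => hB _ (Finset.mem_toRight.1 hp)
  have hW : ∀ W : Finset (Fin r), (∀ w ∈ W, .inl w ∉ B) → B.toLeft.card + W.card ≤ r := by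
    intro W h
    rw [← Finset.card_union_of_disjoint
      (Finset.disjoint_right.2 fun w hw hw' => h w hw (Finset.mem_toLeft.1 hw'))]
    simpa using Finset.card_le_univ (B.toLeft ∪ W)
  have hSB : ∀ w, .inl w ∈ S → .inl w ∉ B := fun w hw hwB => (hB _ hwB).1 hw
  rw [← Finset.card_toLeft_add_card_toRight (u := B)]
  have hR2 : B.toRight.card ≤ 2 := by
    by_contra! hcard
    obtain ⟨a, ha, b, hb, c, hc, hab, hac, hbc⟩ := Finset.two_lt_card.1 hcard
    have key : ∀ p ∈ B.toRight, ∀ q ∈ B.toRight, ∀ t ∈ B.toRight, p < q → ¬ q < t :=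
      fun p hp q hq t ht hpq hqt =>
        false_of_three hS hu hz ho hpq hqt (hR p hp).1 (hR q hq).1 (hR t ht).1 (hR q hq).2
    have := key a ha b hb c hc
    have := key a ha c hc b hb
    have := key b hb a ha c hc
    have := key b hb c hc a ha
    have := key c hc a ha b hb
    have := key c hc b hb a ha
    omega
  obtain h0 | h1 | h2 : B.toRight.card = 0 ∨ B.toRight.card = 1 ∨ B.toRight.card = 2 := by omega
  · have := hW {u} (by simpa using hSB u hu)
    rw [Finset.card_singleton] at this
    omega
  · obtain ⟨p, hp⟩ := Finset.card_pos.1 (h1 ▸ Nat.one_pos)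
    obtain ⟨v, w, hvw, hv, hw⟩ := exists_pair hS hu hz ho (hR p hp).1 (hR p hp).2
    have hwB : .inl w ∉ B := by
      intro hwB
      obtain ⟨hwS, s, hs, hadj⟩ := hB _ hwB
      exact hw.elim hwS fun h => h s hs hadj
    have := hW {v, w} (by simpa using ⟨hSB v hv, hwB⟩)
    rw [Finset.card_pair hvw] at this
    omega
  · obtain ⟨p, hp, q, hq, hpq⟩ : ∃ p ∈ B.toRight, ∃ q ∈ B.toRight, p < q := by
      obtain ⟨p, q, hne, heq⟩ := Finset.card_eq_two.1 h2
      rcases lt_or_gt_of_ne hne with h | h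
      · exact ⟨p, by simp [heq], q, by simp [heq], h⟩
      · exact ⟨q, by simp [heq], p, by simp [heq], h⟩
    obtain ⟨hzS, hoS, w, hwz, hwo, hw⟩ :=
      exists_triple hS hu hz ho hpq (hR p hp).1 (hR q hq).1 (hR p hp).2 (hR q hq).2
    have := hW {w, z, o} (by simpa using ⟨hSB w hw, hSB z hzS, hSB o hoS⟩)
    rw [Finset.card_eq_three.2 ⟨w, z, o, hwz, hwo, by omega, rfl⟩] at this
    omega

end pathReplacedComplete

/-- The complete graph with one edge replaced by a long path has no
`K_{1,r}` minor. -/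
theorem pathReplacedComplete_no_star_minor (r ℓ : ℕ) (hr : 3 ≤ r) (hℓ : 2 ≤ ℓ) :
    ¬ (completeBipartiteGraph (Fin 1) (Fin r)).IsMinorOf (pathReplacedComplete r ℓ) := by
  classical
  rintro ⟨B, -, hconn, hdisj, hadj⟩
  have h : ∀ i : Fin r, ∃ v ∈ B (.inr i), ∃ s ∈ B (.inl 0), (pathReplacedComplete r ℓ).Adj s v := by
    intro i
    obtain ⟨s, hs, v, hv, hsv⟩ := hadj (w₁ := .inl 0) (w₂ := .inr i) (by simp)
    exact ⟨v, hv, s, hs, hsv⟩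
  choose f hf hfN using h
  have hinj : Function.Injective f := by
    intro i j hij
    by_contra hne
    exact Set.disjoint_left.1 (hdisj (Sum.inr_injective.ne hne)) (hf i) (hij ▸ hf j)
  have hlt := pathReplacedComplete.card_outer_neighbours_lt hr hℓ (hconn (.inl 0))
    (Finset.univ.image f) (by
      simp only [Finset.mem_image, Finset.mem_univ, true_and, forall_exists_index,
        forall_apply_eq_imp_iff]
      exact fun i => ⟨fun hi => Set.disjoint_left.1 (hdisj Sum.inl_ne_inr) hi (hf i), hfN i⟩)
  simp [Finset.card_image_of_injective _ hinj] at hlt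
end

section
/- Let H be a connected simple graph with at least 3 vertices. Then every M(H)-saturated simple graph on n vertices has at most one isolated vertex, and consequently has at least (n-1)/2 edges. -/
theorem SimpleGraph.Preconnected.of_adj_closed {V : Type*} {G : SimpleGraph V}
    (hG : G.Preconnected) {p : V → Prop} (hp : ∀ a b, G.Adj a b → p a → p b)
    {a : V} (ha : p a) (b : V) : p b := by
  obtain ⟨q⟩ := hG a b
  induction q with
  | nil => exact ha
  | cons hadj _ ih => exact ih (hp _ _ hadj ha)

theorem SimpleGraph.addEdge_adj {V : Type*} {G : SimpleGraph V} {u v a b : V} :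
    (G.addEdge u v).Adj a b ↔ G.Adj a b ∨ (s(a, b) = s(u, v) ∧ a ≠ b) := by
  simp [SimpleGraph.addEdge]

/-- An edge added between two isolated vertices does not help to create a minor that is
connected and has at least three vertices. -/
theorem SimpleGraph.IsMinorOf.of_addEdge_of_isolated {W V : Type*} [Fintype W]
    {H : SimpleGraph W} (hconn : H.Connected) (hW : 3 ≤ Fintype.card W)
    {G : SimpleGraph V} {u v : V} (hu : ∀ w, ¬ G.Adj u w) (hv : ∀ w, ¬ G.Adj v w)
    (h : H.IsMinorOf (G.addEdge u v)) : H.IsMinorOf G := by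
  obtain ⟨B, hne, hc, hd, he⟩ := h
  have hclosed : ∀ a b, (G.addEdge u v).Adj a b → a = u ∨ a = v → b = u ∨ b = v := by
    intro a b hab ha
    rw [addEdge_adj, Sym2.eq_iff] at hab
    rcases hab with hab | ⟨⟨-, rfl⟩ | ⟨-, rfl⟩, -⟩
    · rcases ha with rfl | rfl
      · exact absurd hab (hu b)
      · exact absurd hab (hv b)
    · exact Or.inr rfl
    · exact Or.inl rfl
  have hsub : ∀ w, ∀ x ∈ B w, (x = u ∨ x = v) → ∀ y ∈ B w, y = u ∨ y = v := by
    intro w x hx hxu y hy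
    exact (hc w).preconnected.of_adj_closed (p := fun z => z.1 = u ∨ z.1 = v)
      (fun a b hab => hclosed a.1 b.1 hab) (a := ⟨x, hx⟩) hxu ⟨y, hy⟩
  have havoid : ∀ w, ∀ x ∈ B w, ¬ (x = u ∨ x = v) := by
    intro w x hx hxu
    have hall : ∀ w', ∀ y ∈ B w', y = u ∨ y = v := by
      refine hconn.preconnected.of_adj_closed (p := fun w' => ∀ y ∈ B w', y = u ∨ y = v)
        ?_ (hsub w x hx hxu)
      intro a b hab ha
      obtain ⟨y, hy, z, hz, hyz⟩ := he hab
      exact hsub b z hz (hclosed y z hyz (ha y hy))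
    choose f hf using hne
    have hinj : Function.Injective f := by
      intro a b hab
      by_contra hne
      exact Set.disjoint_left.1 (hd hne) (hf a) (hab ▸ hf b)
    classical
    have hcard : (Finset.univ.image f).card ≤ ({u, v} : Finset V).card := by
      refine Finset.card_le_card fun y hy => ?_
      obtain ⟨w', -, rfl⟩ := Finset.mem_image.1 hy
      simpa using hall w' _ (hf w')
    rw [Finset.card_image_of_injective _ hinj, Finset.card_univ] at hcard
    have := Finset.card_le_two (a := u) (b := v)
    omega
  have hadj : ∀ {w a b}, a ∈ B w → (G.addEdge u v).Adj a b → G.Adj a b := by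
    intro w a b ha hab
    rw [addEdge_adj, Sym2.eq_iff] at hab
    rcases hab with hab | ⟨⟨rfl, -⟩ | ⟨rfl, -⟩, -⟩
    · exact hab
    · exact absurd (Or.inl rfl) (havoid w _ ha)
    · exact absurd (Or.inr rfl) (havoid w _ ha)
  refine ⟨B, hne, fun w => (hc w).mono fun a b hab => hadj a.2 hab, hd, fun w₁ w₂ hw => ?_⟩
  obtain ⟨a, ha, b, hb, hab⟩ := he hw
  exact ⟨a, ha, b, hb, hadj ha hab⟩

/-- A finite graph with at most one isolated vertex has at least `(|V| - 1) / 2` edges. -/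
theorem SimpleGraph.card_le_two_mul_ncard_edgeSet_add_one {V : Type*} [Fintype V]
    {G : SimpleGraph V} (h : {v : V | ∀ w : V, ¬ G.Adj v w}.Subsingleton) :
    Fintype.card V ≤ 2 * G.edgeSet.ncard + 1 := by
  classical
  have hisol : (Finset.univ.filter fun v : V => ∀ w : V, ¬ G.Adj v w).card ≤ 1 :=
    Finset.card_le_one.2 fun a ha b hb => h (by simpa using ha) (by simpa using hb)
  have hsum : (Finset.univ.filter fun v : V => ¬ ∀ w : V, ¬ G.Adj v w).card
      ≤ ∑ v, G.degree v := by
    rw [Finset.card_filter]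
    refine Finset.sum_le_sum fun v _ => ?_
    split_ifs with hv
    · exact Nat.zero_le _
    · push Not at hv
      exact (G.degree_pos_iff_exists_adj v).2 hv
  rw [G.sum_degrees_eq_twice_card_edges] at hsum
  rw [← G.coe_edgeFinset, Set.ncard_coe_finset]
  have := Finset.card_filter_add_card_filter_not (s := (Finset.univ : Finset V))
    (fun v : V => ∀ w : V, ¬ G.Adj v w)
  rw [Finset.card_univ] at this
  omega

/-- If `H` is connected with at least `3` vertices, then every
`M(H)`-saturated graph on `n` vertices has at most one isolated vertex, and hence at
least `(n-1)/2` edges. -/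
theorem sat_minor_isolated_vertices_and_lower_bound
    {W : Type*} [Fintype W] (H : SimpleGraph W) (hconn : H.Connected)
    (hW : 3 ≤ Fintype.card W)
    {V : Type*} [Fintype V] (G : SimpleGraph V) (n : ℕ) (hV : Fintype.card V = n)
    (hsat : MinorSaturated H G) :
    {v : V | ∀ w : V, ¬ G.Adj v w}.Subsingleton ∧
      ((n : ℚ) - 1) / 2 ≤ (G.edgeSet.ncard : ℚ) := by
  have hiso : {v : V | ∀ w : V, ¬ G.Adj v w}.Subsingleton := by
    intro u hu v hv
    by_contra huv
    exact hsat.1 ((hsat.2 u v huv (hu v)).of_addEdge_of_isolated hconn hW hu hv)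
  refine ⟨hiso, ?_⟩
  have hcard : (n : ℚ) ≤ 2 * G.edgeSet.ncard + 1 := by
    exact_mod_cast hV ▸ SimpleGraph.card_le_two_mul_ncard_edgeSet_add_one hiso
  linarith
end
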